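/- Strictness remark. There exist a nonrecursive limit computable set A ⊆ ℕ, a family {B_q}_{q ∈ ℚ ∩ (1,2)} and a family {W_n}_{n ∈ ℕ} of subsets of ℕ such that: B_q ≡_bfo A and A <₁ B_q for every q ∈ ℚ ∩ (1,2); W_n ≡_bfo A and A <₁ W_n for every n ∈ ℕ; B_p <₁ B_q whenever p < q in ℚ ∩ (1,2); and ¬(W_n ≤₁ W_m) whenever n ≠ m. Thus both the copy of (ℚ, ≤) and the infinite antichain lie strictly above the 1-degree of A inside the bounded finite-one degree of A. -/

import Mathlib

/-- One-one reducibility: `B ≤₁ C` via a total computable injective function. -/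
def OneOneRed (B C : Set ℕ) : Prop :=
  ∃ f : ℕ → ℕ, Computable f ∧ Function.Injective f ∧ ∀ x, x ∈ B ↔ f x ∈ C

/-- Strict one-one reducibility: `B <₁ C`. -/
def OneOneLt (B C : Set ℕ) : Prop :=
  OneOneRed B C ∧ ¬ OneOneRed C B

/-- Bounded finite-one reducibility: `B ≤_bfo C` via a total computable function
all of whose fibers have size at most some constant `c ≥ 1`. -/
def BfoRed (B C : Set ℕ) : Prop :=
  ∃ f : ℕ → ℕ, Computable f ∧
    (∃ c : ℕ, 1 ≤ c ∧ ∀ y, {x | f x = y}.encard ≤ (c : ℕ∞)) ∧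
    ∀ x, x ∈ B ↔ f x ∈ C

/-- Bounded finite-one equivalence: `B ≡_bfo C`. -/
def BfoEquiv (B C : Set ℕ) : Prop :=
  BfoRed B C ∧ BfoRed C B

/-- `A` is limit computable (equivalently `A ≤_T ∅'`, i.e. `Δ⁰₂`). -/
def LimitComputable (A : Set ℕ) : Prop :=
  ∃ g : ℕ → ℕ → Bool, Computable₂ g ∧
    ∀ n, ∃ s₀, ∀ s, s₀ ≤ s → (g s n = true ↔ n ∈ A)

/-- `a_k`, the left endpoint of the `k`-th block `I_k = [a_k, a_{k+1})`;
`a_0 = 0` and `a_{k+1} = a_k + k!`. -/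
def blockStart (k : ℕ) : ℕ := ∑ m ∈ Finset.range k, Nat.factorial m

namespace SR

open Nat.Partrec (Code)

/-- Block of zeros. -/
def zeros (d : ℕ) : List Bool := (List.range d).map (fun _ => false)

/-- Diagonalizing extension of the finite string `σ`. -/
def ext (σ : List Bool) (d h : ℕ) : List Bool :=
  (σ ++ zeros d) ++ ((!σ.getD h false) :: zeros h)

/-- Step `k` of the finite extension construction with time bound `s`. -/
def step (s k : ℕ) (σ : List Bool) : List Bool :=
  Option.casesOn (Code.evaln s (Denumerable.ofNat Code k) σ.length) (σ ++ [false])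
    (fun p => ext σ p.unpair.1 p.unpair.2)

/-- The string after `k` steps, with time bound `s`. -/
def sq (s k : ℕ) : List Bool := Nat.rec [false] (fun k σ => step s k σ) k

theorem zeros_primrec : Primrec zeros :=
  Primrec.list_map Primrec.list_range (Primrec.const false).to₂

theorem ext_primrec : Primrec fun a : List Bool × (ℕ × ℕ) => ext a.1 a.2.1 a.2.2 := by
  have hd := Primrec.fst.comp (Primrec.snd (α := List Bool) (β := ℕ × ℕ))
  have hh := Primrec.snd.comp (Primrec.snd (α := List Bool) (β := ℕ × ℕ))
  have hs := Primrec.fst (α := List Bool) (β := ℕ × ℕ)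
  exact Primrec.list_append.comp (Primrec.list_append.comp hs (zeros_primrec.comp hd))
    (Primrec.list_cons.comp (Primrec.not.comp ((Primrec.list_getD false).comp hs hh))
      (zeros_primrec.comp hh))

theorem step_primrec : Primrec fun a : ℕ × (ℕ × List Bool) => step a.1 a.2.1 a.2.2 := by
  have hs := Primrec.fst (α := ℕ) (β := ℕ × List Bool)
  have hk := Primrec.fst.comp (Primrec.snd (α := ℕ) (β := ℕ × List Bool))
  have hl := Primrec.snd.comp (Primrec.snd (α := ℕ) (β := ℕ × List Bool))
  have h1 : Primrec fun a : ℕ × (ℕ × List Bool) =>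
      Code.evaln a.1 (Denumerable.ofNat Code a.2.1) a.2.2.length :=
    Code.primrec_evaln.comp
      ((hs.pair ((Primrec.ofNat Code).comp hk)).pair (Primrec.list_length.comp hl))
  refine Primrec.option_casesOn h1 (Primrec.list_append.comp hl (Primrec.const [false])) ?_
  exact (ext_primrec.comp ((hl.comp Primrec.fst).pair
    (Primrec.unpair.comp Primrec.snd))).to₂

theorem sq_primrec : Primrec₂ sq := by
  refine Primrec.nat_rec (α := ℕ) (f := fun _ => [false])
    (g := fun s a => step s a.1 a.2) (Primrec.const [false]) ?_
  exact step_primrec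

theorem step_stable (k : ℕ) (σ : List Bool) :
    ∃ τ s₀, ∀ s, s₀ ≤ s → step s k σ = τ := by
  by_cases h : ∃ s p, p ∈ Code.evaln s (Denumerable.ofNat Code k) σ.length
  · obtain ⟨s₀, p, hp⟩ := h
    refine ⟨ext σ p.unpair.1 p.unpair.2, s₀, fun s hs => ?_⟩
    have := Code.evaln_mono hs hp
    rw [Option.mem_def] at this
    simp only [step, this]
  · push Not at h
    refine ⟨σ ++ [false], 0, fun s _ => ?_⟩
    have : Code.evaln s (Denumerable.ofNat Code k) σ.length = none :=
      Option.eq_none_iff_forall_not_mem.2 (h s)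
    simp only [step, this]

theorem sq_stable (k : ℕ) : ∃ τ s₀, ∀ s, s₀ ≤ s → sq s k = τ := by
  induction k with
  | zero => exact ⟨[false], 0, fun _ _ => rfl⟩
  | succ k ih =>
    obtain ⟨σ, s₀, h₀⟩ := ih
    obtain ⟨τ, s₁, h₁⟩ := step_stable k σ
    refine ⟨τ, max s₀ s₁, fun s hs => ?_⟩
    have : sq s (k+1) = step s k (sq s k) := rfl
    rw [this, h₀ s (by omega), h₁ s (by omega)]

/-- Limit string. -/
noncomputable def L (k : ℕ) : List Bool := (sq_stable k).choose

theorem L_spec (k : ℕ) : ∃ s₀, ∀ s, s₀ ≤ s → sq s k = L k := (sq_stable k).choose_spec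

theorem step_prefix (s k : ℕ) (σ : List Bool) :
    σ <+: step s k σ ∧ σ.length < (step s k σ).length := by
  unfold step
  cases Code.evaln s (Denumerable.ofNat Code k) σ.length with
  | none => simp
  | some p => simp [ext]

theorem L_succ (k : ℕ) : ∃ s₀, ∀ s, s₀ ≤ s → L (k+1) = step s k (L k) := by
  obtain ⟨a, ha⟩ := L_spec k
  obtain ⟨b, hb⟩ := L_spec (k+1)
  refine ⟨max a b, fun s hs => ?_⟩
  rw [← hb s (by omega), ← ha s (by omega)]
  rfl

theorem L_prefix (k : ℕ) : L k <+: L (k+1) ∧ (L k).length < (L (k+1)).length := by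
  obtain ⟨s, hs⟩ := L_succ k
  rw [hs s le_rfl]
  exact step_prefix _ _ _

theorem L_mono {j k : ℕ} (h : j ≤ k) : L j <+: L k := by
  induction h with
  | refl => exact List.prefix_rfl
  | step _ ih => exact ih.trans (L_prefix _).1

theorem L_zero : L 0 = [false] := by
  obtain ⟨s, hs⟩ := L_spec 0
  exact (hs s le_rfl).symm

theorem L_length (k : ℕ) : k < (L k).length := by
  induction k with
  | zero => simp [L_zero]
  | succ k ih => have := (L_prefix k).2; omega

/-- The generic set. -/
noncomputable def G (n : ℕ) : Bool := (L n).getD n false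

theorem prefix_getD {σ τ : List Bool} (h : σ <+: τ) {n : ℕ} (hn : n < σ.length) :
    τ.getD n false = σ.getD n false := by
  obtain ⟨r, rfl⟩ := h
  exact List.getD_append _ _ _ _ hn

theorem G_eq {k n : ℕ} (hn : n < (L k).length) : G n = (L k).getD n false := by
  rcases le_total k n with h | h
  · exact prefix_getD (L_mono h) hn
  · exact (prefix_getD (L_mono h) (L_length n)).symm

theorem G_zero : G 0 = false := by simp [G, L_zero]

theorem zeros_length (d : ℕ) : (zeros d).length = d := by simp [zeros]

theorem zeros_getD (d n : ℕ) : (zeros d).getD n false = false := by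
  rw [List.getD_eq_getElem?_getD]
  simp only [zeros, List.getElem?_map]
  cases (List.range d)[n]? <;> rfl

theorem ext_length (σ : List Bool) (d h : ℕ) :
    (ext σ d h).length = σ.length + d + 1 + h := by
  simp [ext, zeros_length]; omega

theorem ext_at (σ : List Bool) (d h : ℕ) :
    (ext σ d h).getD (σ.length + d) false = !σ.getD h false := by
  unfold ext
  rw [List.getD_append_right _ _ _ _ (by simp [zeros_length])]
  simp [zeros_length]

theorem ext_ne (σ : List Bool) (d h n : ℕ) (hn : n ≠ σ.length + d) :
    (ext σ d h).getD n false = σ.getD n false := by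
  unfold ext
  by_cases h1 : n < σ.length
  · rw [List.append_assoc, List.getD_append _ _ _ _ h1]
  · have h0 : σ.getD n false = false := List.getD_eq_default _ _ (by omega)
    rw [h0]
    by_cases h2 : n < σ.length + d
    · rw [List.getD_append _ _ _ _ (by simpa [zeros_length] using h2),
        List.getD_append_right _ _ _ _ (by omega), zeros_getD]
    · rw [List.getD_append_right _ _ _ _ (by simp [zeros_length]; omega)]
      obtain ⟨j, hj⟩ : ∃ j, n - (σ ++ zeros d).length = j + 1 :=
        ⟨n - (σ ++ zeros d).length - 1, by simp [zeros_length]; omega⟩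
      rw [hj, List.getD_cons_succ, zeros_getD]

theorem diag {d h : ℕ → ℕ} (hd : Computable d) (hh : Computable h) :
    ∃ m, 1 ≤ m ∧ (h m ≠ m + d m → G (m + d m) = !G (h m)) := by
  have hf : Computable fun m => Nat.pair (d m) (h m) := Primrec₂.natPair.to_comp.comp hd hh
  obtain ⟨c, hc⟩ := Code.exists_code.1 (Partrec.nat_iff.1 hf.partrec)
  set k := Encodable.encode c with hk
  obtain ⟨s₀, hs₀⟩ := L_succ k
  refine ⟨(L k).length, by have := L_length k; omega, fun hne => ?_⟩
  set m := (L k).length with hm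
  have h1 : Nat.pair (d m) (h m) ∈ c.eval m := by rw [hc]; simp
  obtain ⟨s₁, hs₁⟩ := Code.evaln_complete.1 h1
  have h2 := Code.evaln_mono (le_max_right s₀ s₁) hs₁
  have h3 : L (k+1) = ext (L k) (d m) (h m) := by
    rw [hs₀ _ (le_max_left s₀ s₁)]
    rw [Option.mem_def] at h2
    simp only [step, hk, Denumerable.ofNat_encode]
    rw [← hk, ← hm, h2]
    simp
  have hl := ext_length (L k) (d m) (h m)
  rw [← h3] at hl
  rw [G_eq (k := k+1) (n := m + d m) (by omega), G_eq (k := k+1) (n := h m) (by omega), h3,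
    ext_ne _ _ _ _ hne, hm, ext_at]

theorem G_limit : ∃ g : ℕ → ℕ → Bool, Computable₂ g ∧
    ∀ n, ∃ s₀, ∀ s, s₀ ≤ s → g s n = G n := by
  refine ⟨fun s n => (sq s n).getD n false, ?_, fun n => ?_⟩
  · exact ((Primrec.list_getD false).comp sq_primrec Primrec.snd).to₂.to_comp
  · obtain ⟨s₀, h⟩ := L_spec n
    exact ⟨s₀, fun s hs => by dsimp only; rw [h s hs]; rfl⟩

/-! ### The sets `A^D` -/

/-- `u` codes a genuine copy of `u / 3`. -/
def gd (D : ℕ → Bool) (u : ℕ) : Bool := (u % 3 == 0) || ((u % 3 == 1) && D (u / 3))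

/-- Projection to the base; junk goes to `0`. -/
def pr (D : ℕ → Bool) (u : ℕ) : ℕ := bif gd D u then u / 3 else 0

/-- `A` with the elements of `D` duplicated, and junk added. -/
def Dup (D : ℕ → Bool) : Set ℕ := {u | G (pr D u) = true}

theorem div3 : Computable fun u : ℕ => u / 3 :=
  (Primrec.nat_div.comp Primrec.id (Primrec.const 3)).to_comp

theorem gd_comp {D : ℕ → Bool} (hD : Computable D) : Computable (gd D) := by
  have hm (i : ℕ) : Computable fun u : ℕ => u % 3 == i :=
    (Primrec.beq.comp (Primrec.nat_mod.comp Primrec.id (Primrec.const 3))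
      (Primrec.const i)).to_comp
  exact Primrec.or.to_comp.comp (hm 0) (Primrec.and.to_comp.comp (hm 1) (hD.comp div3))

theorem pr_comp {D : ℕ → Bool} (hD : Computable D) : Computable (pr D) :=
  Computable.cond (gd_comp hD) div3 (Computable.const 0)

theorem junk_comp : Computable fun u : ℕ => 3 * u + 2 :=
  (Primrec.nat_add.comp (Primrec.nat_mul.comp (Primrec.const 3) Primrec.id)
    (Primrec.const 2)).to_comp

theorem gd_iff (D : ℕ → Bool) (u : ℕ) :
    gd D u = true ↔ (u % 3 = 0 ∨ (u % 3 = 1 ∧ D (u / 3) = true)) := by simp [gd]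

theorem junk_mem (D : ℕ → Bool) (u : ℕ) : 3 * u + 2 ∉ Dup D := by
  have : gd D (3 * u + 2) = false := by
    rw [← Bool.not_eq_true, gd_iff]; omega
  simp [Dup, pr, this, G_zero]

theorem mem_of_gd {D : ℕ → Bool} {u : ℕ} (h : gd D u = true) :
    u ∈ Dup D ↔ G (u / 3) = true := by simp [Dup, pr, h]

theorem mem_of_not_gd {D : ℕ → Bool} {u : ℕ} (h : gd D u = false) : u ∉ Dup D := by
  simp [Dup, pr, h, G_zero]

theorem dup_le {D E : ℕ → Bool} (hD : Computable D) (h : ∀ x, D x = true → E x = true) :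
    OneOneRed (Dup D) (Dup E) := by
  refine ⟨fun u => bif gd D u then u else 3 * u + 2,
    Computable.cond (gd_comp hD) Computable.id junk_comp, ?_, ?_⟩
  · intro u v huv
    dsimp only at huv
    have hu := gd_iff D u
    have hv := gd_iff D v
    cases h1 : gd D u <;> cases h2 : gd D v <;> simp [h1, h2] at huv hu hv <;> omega
  · intro u
    dsimp only
    cases h1 : gd D u
    · simp only [cond_false, mem_of_not_gd h1, junk_mem]
    · have h2 : gd E u = true := by
        rw [gd_iff] at h1 ⊢
        exact h1.imp_right fun a => ⟨a.1, h _ a.2⟩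
      simp only [cond_true, mem_of_gd h1, mem_of_gd h2]

theorem bfo_of_one {B C : Set ℕ} (h : OneOneRed B C) : BfoRed B C := by
  obtain ⟨f, hf, hi, h⟩ := h
  refine ⟨f, hf, ⟨1, le_rfl, fun y => ?_⟩, h⟩
  rw [Nat.cast_one, Set.encard_le_one_iff]
  intro a b ha hb
  exact hi (ha.trans hb.symm)

theorem dup_bfo {D E : ℕ → Bool} (hD : Computable D) : BfoRed (Dup D) (Dup E) := by
  refine ⟨fun u => bif gd D u then 3 * (u / 3) else 3 * u + 2, ?_, ⟨3, by norm_num, ?_⟩, ?_⟩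
  · exact Computable.cond (gd_comp hD)
      (Primrec.nat_mul.to_comp.comp (Computable.const 3) div3) junk_comp
  · intro y
    have : {x | (bif gd D x then 3 * (x / 3) else 3 * x + 2) = y} ⊆
        (({y, y + 1, (y - 2) / 3} : Finset ℕ) : Set ℕ) := by
      intro x hx
      have hu := gd_iff D x
      simp only [Set.mem_ofPred_eq] at hx
      simp only [Finset.coe_insert, Finset.coe_singleton, Set.mem_insert_iff,
        Set.mem_singleton_iff]
      cases h1 : gd D x <;> simp [h1] at hx hu <;> omega
    refine (Set.encard_le_encard this).trans ?_
    rw [Set.encard_coe_eq_coe_finsetCard]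
    exact_mod_cast Finset.card_le_three
  · intro u
    dsimp only
    cases h1 : gd D u
    · simp only [cond_false, mem_of_not_gd h1, junk_mem]
    · have h2 : gd E (3 * (u / 3)) = true := by rw [gd_iff]; omega
      simp only [cond_true, mem_of_gd h1, mem_of_gd h2]
      rw [Nat.mul_div_cancel_left _ (by norm_num)]

theorem dup_not_le {D E : ℕ → Bool} (hD : Computable D) (s : ℕ → ℕ) (hs : Computable s)
    (h : ∀ m, m ≤ s m ∧ E (s m) = true ∧ D (s m) = false) :
    ¬ OneOneRed (Dup E) (Dup D) := by
  rintro ⟨f, hf, hi, hr⟩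
  have h3 : Computable fun m => 3 * s m :=
    Primrec.nat_mul.to_comp.comp (Computable.const 3) hs
  set u : ℕ → ℕ := fun m =>
    bif f (3 * s m) == 3 * s m then f (3 * s m + 1) else f (3 * s m) with hu
  have huc : Computable u :=
    Computable.cond (Primrec.beq.to_comp.comp (hf.comp h3) h3)
      (hf.comp (Computable.succ.comp h3)) (hf.comp h3)
  have hd : Computable fun m => s m - m := Primrec.nat_sub.to_comp.comp hs Computable.id
  obtain ⟨m, hm, hG⟩ := diag hd ((pr_comp hD).comp huc)
  obtain ⟨hms, hE, hDs⟩ := h m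
  have e : m + (s m - m) = s m := by omega
  rw [e] at hG
  have m0 : 3 * s m ∈ Dup E ↔ G (s m) = true := by
    rw [mem_of_gd (by rw [gd_iff]; omega), Nat.mul_div_cancel_left _ (by norm_num)]
  have m1 : 3 * s m + 1 ∈ Dup E ↔ G (s m) = true := by
    have : (3 * s m + 1) / 3 = s m := by omega
    rw [mem_of_gd (by rw [gd_iff, this]; exact Or.inr ⟨by omega, hE⟩), this]
  have hmem : u m ∈ Dup D ↔ G (s m) = true := by
    simp only [hu]
    cases (f (3 * s m) == 3 * s m)
    · rw [cond_false, ← hr, m0]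
    · rw [cond_true, ← hr, m1]
  have hne : u m ≠ 3 * s m := by
    simp only [hu]
    cases hb : (f (3 * s m) == 3 * s m)
    · rw [cond_false]; simpa using hb
    · rw [cond_true]
      rw [beq_iff_eq] at hb
      intro h'
      have := hi (h'.trans hb.symm)
      omega
  have hp : pr D (u m) ≠ s m := by
    unfold pr
    cases hg : gd D (u m)
    · rw [cond_false]; omega
    · rw [cond_true]
      intro h'
      rw [gd_iff, h', hDs] at hg
      simp at hg
      omega
  have hG' := hG hp
  have hmem' : G (pr D (u m)) = true ↔ G (s m) = true := hmem
  rw [hG'] at hmem'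
  simp at hmem'

theorem G_not_comp : ¬ Computable G := by
  intro hG
  obtain ⟨a, ha1, ha⟩ := diag (Computable.const 0) (Computable.const 0)
  obtain ⟨b, hb1, hb⟩ := diag (Computable.const (a + 1)) (Computable.const 0)
  have ha' := ha (by omega)
  have hb' := hb (by omega)
  rw [G_zero] at ha' hb'
  have hh : Computable fun m => bif G m then (bif m == a then b + (a + 1) else a) else 0 :=
    Computable.cond hG (Computable.cond
      (Primrec.beq.to_comp.comp Computable.id (Computable.const a))
      (Computable.const _) (Computable.const _)) (Computable.const _)
  obtain ⟨m, hm1, hm⟩ := diag (Computable.const 0) hh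
  try dsimp only at hm
  rw [Nat.add_zero] at hm ha'
  cases h1 : G m
  · simp [h1, G_zero] at hm; omega
  · by_cases h2 : m = a
    · subst h2
      simp [h1, hb'] at hm
      omega
    · have : (m == a) = false := by simpa using h2
      simp [h1, this, ha'] at hm
      omega

theorem dup_not_comp (D : ℕ → Bool) : ¬ ComputablePred (· ∈ Dup D) := by
  rintro ⟨i, h⟩
  apply G_not_comp
  have h3 : Computable fun m : ℕ => 3 * m :=
    Primrec.nat_mul.to_comp.comp (Computable.const 3) Computable.id
  refine (h.comp h3).of_eq fun n => ?_
  have m0 : 3 * n ∈ Dup D ↔ G n = true := by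
    rw [mem_of_gd (by rw [gd_iff]; omega), Nat.mul_div_cancel_left _ (by norm_num)]
  rw [Bool.eq_iff_iff, decide_eq_true_iff]
  exact m0

theorem dup_limit {D : ℕ → Bool} (hD : Computable D) : LimitComputable (Dup D) := by
  obtain ⟨g, hg, h⟩ := G_limit
  refine ⟨fun s u => g s (pr D u), hg.comp Computable.fst ((pr_comp hD).comp Computable.snd),
    fun n => ?_⟩
  obtain ⟨s₀, h₀⟩ := h (pr D n)
  exact ⟨s₀, fun s hs => by dsimp only; rw [h₀ s hs]; rfl⟩

/-- The duplicated set for the rational chain. -/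
def DQ (q : ℚ) (x : ℕ) : Bool :=
  decide (x.unpair.1.unpair.1 * q.den < q.num.toNat * (x.unpair.1.unpair.2 + 1))

/-- The duplicated set for the antichain. -/
def DW (n : ℕ) (x : ℕ) : Bool := x.unpair.1 == n

/-- The empty duplicated set. -/
def D0 (_ : ℕ) : Bool := false

theorem D0_comp : Computable D0 := Computable.const false

theorem DW_comp (n : ℕ) : Computable (DW n) :=
  (Primrec.beq.comp (Primrec.fst.comp Primrec.unpair) (Primrec.const n)).to_comp

theorem DQ_comp (q : ℚ) : Computable (DQ q) := by
  have h0 : Primrec fun x : ℕ => x.unpair.1.unpair :=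
    Primrec.unpair.comp (Primrec.fst.comp Primrec.unpair)
  have : PrimrecPred fun x : ℕ =>
      x.unpair.1.unpair.1 * q.den < q.num.toNat * (x.unpair.1.unpair.2 + 1) :=
    Primrec.nat_lt.comp (Primrec.nat_mul.comp (Primrec.fst.comp h0) (Primrec.const _))
      (Primrec.nat_mul.comp (Primrec.const _) (Primrec.succ.comp (Primrec.snd.comp h0)))
  exact this.decide.to_comp

theorem DQ_iff {q : ℚ} (hq : 0 < q) (x : ℕ) :
    DQ q x = true ↔ (x.unpair.1.unpair.1 : ℚ) / (x.unpair.1.unpair.2 + 1) < q := by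
  have hn : (q.num.toNat : ℤ) = q.num := Int.toNat_of_nonneg (Rat.num_pos.2 hq).le
  have hn' : (q.num.toNat : ℚ) = (q.num : ℚ) := by exact_mod_cast hn
  have hd : (0 : ℚ) < q.den := by exact_mod_cast q.den_pos
  unfold DQ
  rw [decide_eq_true_iff, ← Nat.cast_lt (α := ℚ)]
  push_cast
  rw [hn']
  conv_rhs => rw [← Rat.num_div_den q]
  rw [div_lt_div_iff₀ (by positivity) hd]

theorem s_comp (a : ℕ) : Computable fun m => Nat.pair a m :=
  (Primrec₂.natPair.comp (Primrec.const a) Primrec.id).to_comp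

end SR

/-- **Strictness remark.**  There are a nonrecursive limit computable set `A`,
a family `{B_q}_{q ∈ ℚ ∩ (1,2)}`, and a family `{W_n}_{n ∈ ℕ}` with
`B_q ≡_bfo A` and `A <₁ B_q` for every `q ∈ ℚ ∩ (1,2)`, `W_n ≡_bfo A` and
`A <₁ W_n` for every `n`, `B_p <₁ B_q` whenever `p < q` in `ℚ ∩ (1,2)`, and
`¬ W_n ≤₁ W_m` whenever `n ≠ m`.  Thus both the copy of `(ℚ, ≤)` and the
infinite antichain lie strictly above the 1-degree of `A` inside the bounded
finite-one degree of `A`. -/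
theorem strictness_remark :
    ∃ (A : Set ℕ) (B : ℚ → Set ℕ) (W : ℕ → Set ℕ),
      ¬ ComputablePred (· ∈ A) ∧
      LimitComputable A ∧
      (∀ q ∈ Set.Ioo (1 : ℚ) 2, BfoEquiv (B q) A ∧ OneOneLt A (B q)) ∧
      (∀ n, BfoEquiv (W n) A ∧ OneOneLt A (W n)) ∧
      (∀ p ∈ Set.Ioo (1 : ℚ) 2, ∀ q ∈ Set.Ioo (1 : ℚ) 2,
        p < q → OneOneLt (B p) (B q)) ∧
      (∀ n m, n ≠ m → ¬ OneOneRed (W n) (W m)) := by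
  refine ⟨SR.Dup SR.D0, fun q => SR.Dup (SR.DQ q), fun n => SR.Dup (SR.DW n),
    SR.dup_not_comp _, SR.dup_limit SR.D0_comp, ?_, ?_, ?_, ?_⟩
  · intro q hq
    have hq0 : (0 : ℚ) < q := by linarith [hq.1]
    refine ⟨⟨SR.dup_bfo (SR.DQ_comp q), SR.dup_bfo SR.D0_comp⟩,
      SR.dup_le SR.D0_comp (fun x hx => by simp [SR.D0] at hx),
      SR.dup_not_le SR.D0_comp (fun m => Nat.pair (Nat.pair 0 0) m) (SR.s_comp _) fun m => ?_⟩
    refine ⟨Nat.right_le_pair _ _, ?_, rfl⟩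
    rw [SR.DQ_iff hq0]
    simpa using hq0
  · intro n
    refine ⟨⟨SR.dup_bfo (SR.DW_comp n), SR.dup_bfo SR.D0_comp⟩,
      SR.dup_le SR.D0_comp (fun x hx => by simp [SR.D0] at hx),
      SR.dup_not_le SR.D0_comp (fun m => Nat.pair n m) (SR.s_comp _) fun m => ?_⟩
    exact ⟨Nat.right_le_pair _ _, by simp [SR.DW], rfl⟩
  · intro p hp q hq hpq
    have hp0 : (0 : ℚ) < p := by linarith [hp.1]
    have hq0 : (0 : ℚ) < q := by linarith [hq.1]
    refine ⟨SR.dup_le (SR.DQ_comp p) fun x hx => ?_,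
      SR.dup_not_le (SR.DQ_comp p) (fun m => Nat.pair (Nat.pair p.num.toNat (p.den - 1)) m)
        (SR.s_comp _) fun m => ?_⟩
    · rw [SR.DQ_iff hp0] at hx
      rw [SR.DQ_iff hq0]
      exact hx.trans hpq
    · have hn : (p.num.toNat : ℤ) = p.num := Int.toNat_of_nonneg (Rat.num_pos.2 hp0).le
      have hn' : (p.num.toNat : ℚ) = (p.num : ℚ) := by exact_mod_cast hn
      have hd : ((p.den - 1 : ℕ) : ℚ) + 1 = p.den := by
        have : p.den - 1 + 1 = p.den := Nat.sub_add_cancel p.den_pos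
        exact_mod_cast this
      refine ⟨Nat.right_le_pair _ _, ?_, ?_⟩
      · rw [SR.DQ_iff hq0]
        simp only [Nat.unpair_pair]
        rw [hn', hd, Rat.num_div_den]
        exact hpq
      · rw [← Bool.not_eq_true, SR.DQ_iff hp0]
        simp only [Nat.unpair_pair]
        rw [hn', hd, Rat.num_div_den]
        exact lt_irrefl p
  · intro n m hnm
    refine SR.dup_not_le (SR.DW_comp m) (fun k => Nat.pair n k) (SR.s_comp _) fun k => ?_
    exact ⟨Nat.right_le_pair _ _, by simp [SR.DW], by simpa [SR.DW] using hnm⟩
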